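/- arXiv:2110.05191 — 2 statements merged into one kernel-verified Lean document; each statement's English description precedes it below -/
import Mathlib

section
/- Let p be an odd natural number with p ≥ 1, and let A : ℕ → ℕ → ℤ be a double-indexed sequence satisfying A_r(0) = 1 for all r and A_r(k) = (p - r - k)·A_r(k-1) + 4·(p - 2r)·A_{r+1}(k-1) whenever k ≥ 1 and r + k ≤ ⌊p/2⌋. Then A_0(⌊p/2⌋) = (2^p - 1) · ∏_{j=1}^{⌊p/2⌋}(p - j). -/
open Finset Nat in
/-- Solution of the recurrence `A r (k + 1) = (x - r - k - 1) A r k + 4 (x - 2 r) A (r + 1) k`. -/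
theorem recurrence_closed_form {x : ℤ} {M : ℕ} {A : ℕ → ℕ → ℤ} (hA0 : ∀ r, A r 0 = 1)
    (hA : ∀ r k, 1 ≤ k → r + k ≤ M →
      A r k = (x - r - k) * A r (k - 1) + 4 * (x - 2 * r) * A (r + 1) (k - 1)) (k : ℕ) :
    ∀ r, r + k ≤ M → A r k = ∑ i ∈ range (k + 1), (k.choose i : ℤ) *
      ((∏ l ∈ range i, 4 * (x - 2 * r - 2 * l)) * ∏ j ∈ range (k - i), (x - r - k + j)) := by
  induction k with
  | zero => intro r _; simp [hA0]
  | succ k ih =>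
    intro r hr
    have hsum := sum_choose_succ_mul (R := ℤ) (fun i q =>
      (∏ l ∈ range i, 4 * (x - 2 * r - 2 * l)) * ∏ j ∈ range q, (x - r - (k + 1 : ℕ) + j)) k
    rw [hA r (k + 1) (by omega) hr, Nat.add_sub_cancel, ih r (by omega), ih (r + 1) (by omega),
      hsum, mul_sum, mul_sum]
    congr 1
    · refine sum_congr rfl fun i hi => ?_
      rw [Nat.succ_sub (Nat.lt_succ_iff.mp (mem_range.mp hi)), Nat.succ_eq_add_one,
        prod_range_succ' _ (k - i)]
      have h₂ : ∀ j : ℕ, x - r - ((k + 1 : ℕ) : ℤ) + ((j + 1 : ℕ) : ℤ) =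
          x - r - k + j := fun j => by push_cast; ring
      simp only [h₂]
      push_cast
      ring
    · refine sum_congr rfl fun i _ => ?_
      rw [prod_range_succ']
      have h₁ : ∀ l : ℕ, 4 * (x - 2 * r - 2 * ((l + 1 : ℕ) : ℤ)) =
          4 * (x - 2 * ((r + 1 : ℕ) : ℤ) - 2 * l) := fun l => by push_cast; ring
      have h₂ : ∀ j : ℕ, x - r - ((k + 1 : ℕ) : ℤ) + j =
          x - ((r + 1 : ℕ) : ℤ) - k + j := fun j => by push_cast; ring
      simp only [h₁, h₂]
      push_cast
      ring

open Finset Nat in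
theorem prod_four_mul_odd_mul_factorial (i : ℕ) : ∀ m b : ℕ, i + b = m →
    (∏ l ∈ range i, 4 * (2 * (m : ℤ) + 1 - 2 * l)) * m ! * (2 * b + 1)! =
      2 ^ i * (2 * m + 1)! * b ! := by
  induction i with
  | zero => rintro m b rfl; simp; ring
  | succ i ih =>
    intro m b h
    have ih' := ih m (b + 1) (by omega)
    have hm : (m : ℤ) = i + 1 + b := by exact_mod_cast h.symm
    have e : 2 * (b + 1) + 1 = 2 * b + 1 + 1 + 1 := by ring
    rw [e, factorial_succ (2 * b + 1 + 1), factorial_succ (2 * b + 1), factorial_succ b] at ih'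
    rw [prod_range_succ]
    have hb : ((b : ℤ) + 1) ≠ 0 := by positivity
    apply mul_left_cancel₀ hb
    rw [show 2 * (m : ℤ) + 1 - 2 * i = 2 * b + 3 by rw [hm]; ring]
    push_cast at ih' ⊢
    linear_combination 2 * ih'

open Finset Nat in
theorem prod_range_add_mul_factorial (m q : ℕ) :
    (∏ j ∈ range q, ((m : ℤ) + 1 + j)) * m ! = (m + q)! := by
  induction q with
  | zero => simp
  | succ q ih =>
    rw [prod_range_succ, ← Nat.add_assoc, factorial_succ]
    push_cast
    linear_combination ((m : ℤ) + 1 + q) * ih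

open Finset Nat in
/-- The coefficients `n / (n - i) * (n - i).choose i` of the Lucas polynomials, for
`n = a + 2 * (i + 1)`, in factorial form. -/
theorem lucas_coeff_mul_factorial (a i : ℕ) :
    ((a + (i + 1)).choose (i + 1) + (a + i).choose i) * (i + 1)! * a ! =
      (a + 2 * (i + 1)) * (a + i)! := by
  have h₁ := Nat.add_choose_mul_factorial_mul_factorial a (i + 1)
  have h₂ := Nat.add_choose_mul_factorial_mul_factorial a i
  rw [← Nat.add_assoc, factorial_succ] at h₁
  rw [factorial_succ] at h₁ ⊢
  rw [← Nat.add_assoc]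
  linear_combination h₁ + (i + 1) * h₂

open Finset Nat in
theorem choose_mul_prod_mul_prod (b i : ℕ) (m : ℕ) (h : i + 1 + b = m) :
    (m.choose (i + 1) : ℤ) * ((∏ l ∈ range (i + 1), 4 * (2 * (m : ℤ) + 1 - 2 * l)) *
      ∏ j ∈ range b, ((m : ℤ) + 1 + j)) =
    2 ^ (i + 1) * ((2 * m - i).choose (i + 1) + (2 * m - 1 - i).choose i) *
      ∏ j ∈ range m, ((m : ℤ) + 1 + j) := by
  have hU := prod_four_mul_odd_mul_factorial (i + 1) m b h
  have hV := prod_range_add_mul_factorial m b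
  have hW := prod_range_add_mul_factorial m m
  have hT := lucas_coeff_mul_factorial (2 * b + 1) i
  have hC := Nat.add_choose_mul_factorial_mul_factorial b (i + 1)
  rw [Nat.add_comm b, h] at hC
  rw [show 2 * b + 1 + (i + 1) = 2 * m - i by omega, show 2 * b + 1 + i = 2 * m - 1 - i by omega,
    show 2 * b + 1 + 2 * (i + 1) = 2 * m + 1 by omega] at hT
  rw [show m + b = 2 * m - 1 - i by omega] at hV
  rw [← two_mul] at hW
  rw [factorial_succ (2 * m)] at hU
  zify at hT hC
  push_cast at hU
  generalize (∏ l ∈ range (i + 1), 4 * (2 * (m : ℤ) + 1 - 2 * l)) = U at *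
  generalize (∏ j ∈ range b, ((m : ℤ) + 1 + j)) = V at *
  generalize (∏ j ∈ range m, ((m : ℤ) + 1 + j)) = W at *
  have hD : (m ! : ℤ) * b ! * (i + 1)! * (2 * b + 1)! * m ! ≠ 0 := by positivity
  apply mul_left_cancel₀ hD
  generalize (((2 * m - i).choose (i + 1) : ℕ) : ℤ) + ((2 * m - 1 - i).choose i : ℕ) = T at *
  calc _ = ((m.choose (i + 1) : ℤ) * b ! * (i + 1)!) * (U * m ! * (2 * b + 1)!) * (V * m !) := by
        ring
    _ = (m ! * b ! * m ! * 2 ^ (i + 1)) *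
          ((2 * m + 1) * (2 * m - 1 - i)!) * W := by
        rw [hC, hU, hV, ← hW]; ring
    _ = _ := by rw [← hT]; ring

open Finset Nat in
theorem three_mul_sum_antidiagonal_choose_mul_two_pow (n : ℕ) :
    3 * ∑ q ∈ antidiagonal n, (q.1.choose q.2 : ℤ) * 2 ^ q.2 = 2 ^ (n + 1) + (-1) ^ n := by
  induction n using Nat.twoStepInduction with
  | zero => simp
  | one => simp [antidiagonal_succ]
  | more n h₀ h₁ =>
    rw [antidiagonal_succ_succ', sum_cons, sum_cons, sum_map]
    rw [antidiagonal_succ', sum_cons, sum_map] at h₁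
    simp [choose_succ_succ, add_mul, sum_add_distrib, pow_succ, ← mul_assoc, ← sum_mul] at h₀ h₁ ⊢
    linear_combination 2 * h₀ + h₁

open Finset Nat in
theorem sum_choose_mul_two_pow (m : ℕ) :
    3 * ∑ i ∈ range (m + 1), ((2 * m + 1 - i).choose i : ℤ) * 2 ^ i = 4 ^ (m + 1) - 1 := by
  have h := three_mul_sum_antidiagonal_choose_mul_two_pow (2 * m + 1)
  rw [Finset.Nat.sum_antidiagonal_eq_sum_range_succ_mk, ← sum_flip] at h
  have hs : range (m + 1) ⊆ range (2 * m + 1 + 1) := range_subset_range.mpr (by omega)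
  rw [sum_subset hs (f := fun i => ((2 * m + 1 - i).choose i : ℤ) * 2 ^ i)]
  · rw [sum_congr rfl (g := fun i => ((2 * m + 1 - i).choose i : ℤ) * 2 ^ i)] at h
    · rw [h, pow_succ (-1 : ℤ), pow_mul (-1 : ℤ), show 2 * m + 1 + 1 = 2 * (m + 1) by ring,
        pow_mul]
      norm_num
      ring
    · intro i hi
      rw [mem_range] at hi
      simp only [show 2 * m + 1 - (2 * m + 1 - i) = i by omega]
  · intro i _ hi
    rw [mem_range] at hi
    rw [choose_eq_zero_of_lt (by omega)]
    simp

theorem mersenne_representation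
    (p : ℕ) (hp1 : 1 ≤ p) (hodd : Odd p)
    (A : ℕ → ℕ → ℤ)
    (hA0 : ∀ r, A r 0 = 1)
    (hA : ∀ r k, 1 ≤ k → r + k ≤ p / 2 →
      A r k = ((p : ℤ) - r - k) * A r (k - 1) + 4 * ((p : ℤ) - 2 * r) * A (r + 1) (k - 1)) :
    A 0 (p / 2) = (2 ^ p - 1) * ∏ j ∈ Finset.Icc 1 (p / 2), ((p : ℤ) - j) := by
  rw [recurrence_closed_form hA0 hA (p / 2) 0 (by omega)]
  obtain ⟨m, rfl⟩ := hodd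
  rw [show (2 * m + 1) / 2 = m by omega]
  have hprod : ∏ j ∈ Finset.Icc 1 m, (((2 * m + 1 : ℕ) : ℤ) - j) =
      ∏ j ∈ Finset.range m, ((m : ℤ) + 1 + j) := by
    refine Finset.prod_nbij' (fun j => m - j) (fun j => m - j) ?_ ?_ ?_ ?_ ?_ <;>
      intro j hj <;> simp only [Finset.mem_Icc, Finset.mem_range] at hj ⊢ <;> omega
  have hx : ∀ j : ℕ, ((2 * m + 1 : ℕ) : ℤ) - (0 : ℕ) - m + j = m + 1 + j := fun j => by
    push_cast; ring
  have hy : ∀ l : ℕ, ((2 * m + 1 : ℕ) : ℤ) - 2 * (0 : ℕ) - 2 * l = 2 * m + 1 - 2 * l := fun l => by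
    push_cast; ring
  simp only [hprod, hx, hy]
  rw [Finset.sum_range_succ', Finset.sum_congr rfl fun i hi =>
    choose_mul_prod_mul_prod (m - (i + 1)) i m (by rw [Finset.mem_range] at hi; omega),
    ← Finset.sum_mul]
  simp only [Nat.choose_zero_right, Finset.range_zero, Finset.prod_empty, Nat.sub_zero,
    Nat.cast_one, one_mul]
  rw [← add_one_mul]
  congr 1
  rcases m with _ | m
  · simp
  have h₁ := sum_choose_mul_two_pow (m + 1)
  have h₂ := sum_choose_mul_two_pow m
  rw [show 2 * m + 1 = 2 * (m + 1) - 1 by omega] at h₂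
  rw [Finset.sum_range_succ'] at h₁
  have e : ∀ i, 2 * (m + 1) + 1 - (i + 1) = 2 * (m + 1) - i := fun i => by omega
  simp only [e, Nat.choose_zero_right, Nat.cast_one, pow_zero, mul_one] at h₁
  have hsplit : ∑ i ∈ Finset.range (m + 1), (2 : ℤ) ^ (i + 1) *
      (((2 * (m + 1) - i).choose (i + 1) : ℕ) + ((2 * (m + 1) - 1 - i).choose i : ℕ)) =
      ∑ i ∈ Finset.range (m + 1), ((2 * (m + 1) - i).choose (i + 1) : ℤ) * 2 ^ (i + 1) +
      2 * ∑ i ∈ Finset.range (m + 1), ((2 * (m + 1) - 1 - i).choose i : ℤ) * 2 ^ i := by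
    rw [Finset.mul_sum, ← Finset.sum_add_distrib]
    exact Finset.sum_congr rfl fun i _ => by ring
  rw [hsplit]
  have h4 : (2 : ℤ) ^ (2 * (m + 1) + 1) = 2 * 4 ^ (m + 1) := by
    rw [pow_succ, pow_mul]; norm_num; ring
  rw [h4]
  rw [pow_succ (4 : ℤ) (m + 1)] at h₁
  linarith
end

section
/- Let n ≥ 1 be a natural number and let W : ℕ → ℕ → ℤ satisfy W_r(0) = 1 for all r and W_r(k) = 3·(n - r - k)·W_r(k-1) - 2·(n - 2r - δ(n-1))·W_{r+1}(k-1) whenever k ≥ 1 and r + k ≤ ⌊n/2⌋. Then W_0(⌊n/2⌋) = c · ∏_{j=1}^{⌊n/2⌋}(n - j), where c = 2 if n ≡ 0 (mod 12), c = 1 if n ≡ 1, 2, 10 or 11 (mod 12), c = 0 if n ≡ 3 or 9 (mod 12), c = -1 if n ≡ 4, 5, 7 or 8 (mod 12), and c = -2 if n ≡ 6 (mod 12). -/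
open Finset

/-- The two-index recurrence `f r (k + 1) = x * f r k + a r * f (r + 1) k` with `f r 0 = 1` is solved
by a binomial sum. -/
theorem eq_sum_choose_of_recurrence {R : Type*} [CommRing R] (x : R) (a : ℕ → R)
    (f : ℕ → ℕ → R) (N : ℕ) (h0 : ∀ r, f r 0 = 1)
    (hf : ∀ r k, r + k + 1 ≤ N → f r (k + 1) = x * f r k + a r * f (r + 1) k) (k : ℕ) :
    ∀ r, r + k ≤ N →
      f r k = ∑ j ∈ range (k + 1), (k.choose j : R) * (x ^ (k - j) * ∏ i ∈ range j, a (r + i)) := by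
  induction k with
  | zero => intro r _; simp [h0]
  | succ k ih =>
    intro r hr
    rw [hf r k (by omega), ih r (by omega), ih (r + 1) (by omega),
      sum_choose_succ_mul (fun j l ↦ x ^ l * ∏ i ∈ range j, a (r + i)) k, mul_sum, mul_sum]
    congr 1
    · refine sum_congr rfl fun j hj ↦ ?_
      rw [Nat.sub_add_comm (mem_range_succ_iff.1 hj)]
      ring
    · refine sum_congr rfl fun j _ ↦ ?_
      simp only [prod_range_succ', add_zero, add_right_comm r 1, add_assoc]
      ring

/-- Absolute values of the coefficients of the Lucas polynomials: `lucasCoeff n j` is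
`n / (n - j) * (n - j).choose j`. -/
def lucasCoeff : ℕ → ℕ → ℤ
  | 0, 0 => 2
  | _ + 1, 0 => 1
  | 0, _ + 1 => 0
  | 1, _ + 1 => 0
  | n + 2, j + 1 => lucasCoeff (n + 1) (j + 1) + lucasCoeff n j

theorem lucasCoeff_add_two (n j : ℕ) :
    lucasCoeff (n + 2) (j + 1) = lucasCoeff (n + 1) (j + 1) + lucasCoeff n j := by
  rw [lucasCoeff]

theorem lucasCoeff_eq_zero (n : ℕ) : ∀ j, n < 2 * j → lucasCoeff n j = 0 := by
  induction n using Nat.strong_induction_on with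
  | _ n ih =>
    intro j hj
    match n, j, hj with
    | 0, j + 1, _ => rw [lucasCoeff]
    | 1, j + 1, _ => rw [lucasCoeff]
    | n + 2, j + 1, h =>
      rw [lucasCoeff_add_two, ih (n + 1) (by omega) _ (by omega), ih n (by omega) _ (by omega),
        add_zero]

theorem lucasCoeff_mul_factorial (j : ℕ) : ∀ m,
    lucasCoeff (m + 2 * j + 2) (j + 1) * ((j + 1).factorial * m.factorial : ℕ) =
      ((m + 2 * j + 2) * (m + j).factorial : ℕ) := by
  induction j with
  | zero =>
    intro m
    induction m with
    | zero => simp [lucasCoeff]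
    | succ m ih =>
      rw [lucasCoeff_add_two]
      have h1 : lucasCoeff (m + 1 + 2 * 0) 0 = 1 := by rw [lucasCoeff]
      have h2 : m + 1 + 2 * 0 + 1 = m + 2 * 0 + 2 := by omega
      rw [h1, h2]
      simp only [mul_zero, add_zero, zero_add, Nat.factorial_succ] at ih ⊢
      push_cast at ih ⊢
      linear_combination ((m : ℤ) + 1) * ih
  | succ j ihj =>
    intro m
    induction m with
    | zero =>
      rw [lucasCoeff_add_two, lucasCoeff_eq_zero _ _ (by omega)]
      have := ihj 0
      simp only [mul_add, mul_one, zero_add, Nat.factorial_succ, Nat.factorial_zero] at this ⊢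
      push_cast at this ⊢
      linear_combination ((j : ℤ) + 2) * this
    | succ m ih =>
      have h := ihj (m + 1)
      rw [lucasCoeff_add_two]
      have h2 : m + 1 + 2 * (j + 1) + 1 = m + 2 * (j + 1) + 2 := by omega
      have h3 : m + 1 + 2 * (j + 1) = m + 1 + 2 * j + 2 := by omega
      have h4 : m + 1 + (j + 1) = m + j + 2 := by omega
      have h5 : m + (j + 1) = m + j + 1 := by omega
      have h6 : m + 1 + j = m + j + 1 := by omega
      rw [h2, h3, h4]
      rw [h5] at ih
      rw [h6] at h
      simp only [Nat.factorial_succ] at ih h ⊢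
      push_cast at ih h ⊢
      linear_combination ((m : ℤ) + 1) * ih + ((j : ℤ) + 2) * h

theorem lucasCoeff_succ_ratio (m j : ℕ) :
    lucasCoeff (m + 2 * j + 2) (j + 1) * ((j + 1) * (m + j + 1)) =
      lucasCoeff (m + 2 * j + 2) j * ((m + 2) * (m + 1)) := by
  have h := lucasCoeff_mul_factorial j m
  cases j with
  | zero =>
    have h1 : lucasCoeff (m + 2 * 0 + 2) 0 = 1 := by rw [lucasCoeff]
    have hm : (m.factorial : ℤ) ≠ 0 := by exact_mod_cast m.factorial_ne_zero
    rw [h1]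
    simp only [zero_add, Nat.factorial_one, one_mul, mul_zero, add_zero] at h ⊢
    push_cast at h ⊢
    apply mul_left_cancel₀ hm
    linear_combination ((m : ℤ) + 1) * h
  | succ j =>
    have h' := lucasCoeff_mul_factorial j (m + 2)
    have h2 : m + 2 + 2 * j + 2 = m + 2 * (j + 1) + 2 := by omega
    have h3 : m + 2 + j = m + j + 2 := by omega
    have h5 : m + (j + 1) = m + j + 1 := by omega
    rw [h2, h3] at h'
    rw [h5] at h
    have hm : (m.factorial * (j + 1).factorial : ℤ) ≠ 0 := by
      exact_mod_cast mul_ne_zero m.factorial_ne_zero (j + 1).factorial_ne_zero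
    apply mul_left_cancel₀ hm
    simp only [Nat.factorial_succ] at h h' ⊢
    push_cast at h h' ⊢
    linear_combination ((m : ℤ) + j + 2) * h - h'

theorem lucasCoeff_zero_right {n : ℕ} (hn : 1 ≤ n) : lucasCoeff n 0 = 1 := by
  obtain ⟨n, rfl⟩ := Nat.exists_eq_add_of_le' hn
  rw [lucasCoeff]

theorem choose_mul_prod_eq_lucasCoeff {n : ℕ} (hn : 1 ≤ n) (j : ℕ) (hj : 2 * j ≤ n) :
    ((n / 2).choose j : ℚ) *
        ∏ i ∈ range j, (-2 * ((n : ℚ) - 2 * i - ((n - 1) % 2 : ℕ)) / (n - i - 1)) =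
      (-1) ^ j * lucasCoeff n j := by
  induction j with
  | zero => simp [lucasCoeff_zero_right hn]
  | succ j ih =>
    have ih := ih (by omega)
    obtain ⟨m, rfl⟩ : ∃ m, n = m + 2 * j + 2 := ⟨n - 2 * j - 2, by omega⟩
    have hr := congrArg (Int.cast : ℤ → ℚ) (lucasCoeff_succ_ratio m j)
    push_cast at hr
    have hc := congrArg (Nat.cast : ℕ → ℚ) (Nat.choose_succ_right_eq ((m + 2 * j + 2) / 2) j)
    have hq : (2 : ℚ) * (((m + 2 * j + 2) / 2 - j : ℕ) : ℚ) *
        (((m + 2 * j + 2 : ℕ) : ℚ) - 2 * j - ((m + 2 * j + 2 - 1) % 2 : ℕ)) =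
        (m + 2) * (m + 1) := by
      rcases Nat.even_or_odd' m with ⟨t, rfl | rfl⟩
      · rw [show (2 * t + 2 * j + 2) / 2 - j = t + 1 by omega,
          show (2 * t + 2 * j + 2 - 1) % 2 = 1 by omega]
        push_cast; ring
      · rw [show (2 * t + 1 + 2 * j + 2) / 2 - j = t + 1 by omega,
          show (2 * t + 1 + 2 * j + 2 - 1) % 2 = 0 by omega]
        push_cast; ring
    rw [prod_range_succ]
    set h := (m + 2 * j + 2) / 2
    set p := ∏ i ∈ range j, (-2 * (((m + 2 * j + 2 : ℕ) : ℚ) - 2 * i -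
      ((m + 2 * j + 2 - 1) % 2 : ℕ)) / (((m + 2 * j + 2 : ℕ) : ℚ) - i - 1))
    set q := ((m + 2 * j + 2 : ℕ) : ℚ) - 2 * j - ((m + 2 * j + 2 - 1) % 2 : ℕ)
    have hd : ((m + 2 * j + 2 : ℕ) : ℚ) - j - 1 = m + j + 1 := by push_cast; ring
    rw [hd]
    have hd0 : (m + j + 1 : ℚ) ≠ 0 := by positivity
    have hj0 : (j + 1 : ℚ) ≠ 0 := by positivity
    apply mul_left_cancel₀ (mul_ne_zero hj0 hd0)
    push_cast at hc
    have key : (j + 1 : ℚ) * (m + j + 1) * ((h.choose (j + 1) : ℚ) *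
        (p * (-2 * q / (m + j + 1)))) = (h.choose (j + 1) * (j + 1)) * p * (-2 * q) := by
      field_simp
    rw [key, hc, pow_succ]
    linear_combination (-(h.choose j : ℚ) * p) * hq - (m + 2) * (m + 1) * ih + (-1) ^ j * hr

/-- The alternating sum of Lucas coefficients weighted by powers of `3`; for `h = n / 2` it is
`2 * cos (n * π / 6)`, divided by `√3` when `n` is odd. -/
def lucasSum (n h : ℕ) : ℤ :=
  ∑ j ∈ range (h + 1), (-1) ^ j * lucasCoeff n j * 3 ^ (h - j)

theorem lucasSum_succ_right {n h : ℕ} (hn : n < 2 * (h + 1)) :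
    lucasSum n (h + 1) = 3 * lucasSum n h := by
  rw [lucasSum, sum_range_succ, lucasCoeff_eq_zero n _ hn, lucasSum, mul_sum, mul_zero, zero_mul,
    add_zero]
  refine sum_congr rfl fun j hj ↦ ?_
  rw [Nat.sub_add_comm (mem_range_succ_iff.1 hj)]
  ring

theorem lucasSum_add_two (n h : ℕ) :
    lucasSum (n + 2) (h + 1) = lucasSum (n + 1) (h + 1) - lucasSum n h := by
  rw [lucasSum, lucasSum, sum_range_succ', sum_range_succ' _ (h + 1), lucasSum,
    lucasCoeff_zero_right (by omega), lucasCoeff_zero_right (by omega), add_sub_right_comm,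
    ← sum_sub_distrib]
  congr 1
  refine sum_congr rfl fun j _ ↦ ?_
  rw [lucasCoeff_add_two, Nat.add_sub_add_right]
  ring

theorem lucasSum_even_succ (h : ℕ) :
    lucasSum (2 * (h + 1)) (h + 1) = 3 * lucasSum (2 * h + 1) h - lucasSum (2 * h) h := by
  rw [← lucasSum_succ_right (by omega)]
  exact lucasSum_add_two (2 * h) h

theorem lucasSum_odd_succ (h : ℕ) :
    lucasSum (2 * (h + 1) + 1) (h + 1) =
      lucasSum (2 * (h + 1)) (h + 1) - lucasSum (2 * h + 1) h :=
  lucasSum_add_two (2 * h + 1) h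

theorem lucasSum_twelve_mul (t : ℕ) :
    lucasSum (2 * (6 * t)) (6 * t) = 2 ∧ lucasSum (2 * (6 * t) + 1) (6 * t) = 1 := by
  induction t with
  | zero => simp [lucasSum, lucasCoeff]
  | succ t ih =>
    obtain ⟨h1, h2⟩ := ih
    have e := fun i ↦ lucasSum_even_succ (6 * t + i)
    have o := fun i ↦ lucasSum_odd_succ (6 * t + i)
    have e0 := e 0; have e1 := e 1; have e2 := e 2; have e3 := e 3; have e4 := e 4; have e5 := e 5
    have o0 := o 0; have o1 := o 1; have o2 := o 2; have o3 := o 3; have o4 := o 4; have o5 := o 5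
    simp only [add_assoc, Nat.reduceAdd, add_zero] at *
    rw [show 6 * (t + 1) = 6 * t + 6 by ring]
    constructor <;> linarith

theorem lucasSum_half (n : ℕ) : lucasSum n (n / 2) =
      (if n % 12 = 0 then 2
        else if n % 12 = 1 ∨ n % 12 = 2 ∨ n % 12 = 10 ∨ n % 12 = 11 then 1
        else if n % 12 = 3 ∨ n % 12 = 9 then 0
        else if n % 12 = 4 ∨ n % 12 = 5 ∨ n % 12 = 7 ∨ n % 12 = 8 then -1
        else -2 : ℤ) := by
  obtain ⟨t, i, hi, rfl⟩ : ∃ t i, i < 12 ∧ n = 12 * t + i :=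
    ⟨n / 12, n % 12, Nat.mod_lt _ (by norm_num), by omega⟩
  obtain ⟨h1, h2⟩ := lucasSum_twelve_mul t
  have e := fun i ↦ lucasSum_even_succ (6 * t + i)
  have o := fun i ↦ lucasSum_odd_succ (6 * t + i)
  have e0 := e 0; have e1 := e 1; have e2 := e 2; have e3 := e 3; have e4 := e 4
  have o0 := o 0; have o1 := o 1; have o2 := o 2; have o3 := o 3; have o4 := o 4
  have hh : (12 * t + i) / 2 = 6 * t + i / 2 := by omega
  have hm : (12 * t + i) % 12 = i := by omega
  rw [hh, hm]
  clear hh hm e o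
  simp only [mul_add, ← mul_assoc, add_assoc, Nat.reduceAdd, Nat.reduceMul, add_zero] at *
  interval_cases i <;> simp <;> linarith

theorem omega_mod_twelve
    (n : ℕ) (hn : 1 ≤ n)
    (W : ℕ → ℕ → ℤ)
    (hW0 : ∀ r, W r 0 = 1)
    (hW : ∀ r k, 1 ≤ k → r + k ≤ n / 2 →
      W r k = 3 * ((n : ℤ) - r - k) * W r (k - 1)
        - 2 * ((n : ℤ) - 2 * r - ((n - 1) % 2 : ℕ)) * W (r + 1) (k - 1)) :
    W 0 (n / 2) =
      (if n % 12 = 0 then 2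
        else if n % 12 = 1 ∨ n % 12 = 2 ∨ n % 12 = 10 ∨ n % 12 = 11 then 1
        else if n % 12 = 3 ∨ n % 12 = 9 then 0
        else if n % 12 = 4 ∨ n % 12 = 5 ∨ n % 12 = 7 ∨ n % 12 = 8 then -1
        else -2 : ℤ) * ∏ j ∈ Finset.Icc 1 (n / 2), ((n : ℤ) - j) := by
  rw [← lucasSum_half]
  set P : ℕ → ℕ → ℚ := fun r k ↦ ∏ i ∈ range k, ((n : ℚ) - r - 1 - i) with hP
  have hpos : ∀ r k, r + k + 1 ≤ n / 2 → (n : ℚ) - r - 1 - k ≠ 0 := by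
    intro r k h
    have : ((r + 1 + k : ℕ) : ℚ) < n := by exact_mod_cast (by omega : r + 1 + k < n)
    push_cast at this
    exact ne_of_gt (by linarith)
  have hP0 : ∀ r k, r + k ≤ n / 2 → P r k ≠ 0 := fun r k h ↦
    prod_ne_zero_iff.2 fun i hi ↦ hpos r i (by have := mem_range.1 hi; omega)
  have hPs : ∀ r k, P r (k + 1) = P r k * (n - r - 1 - k) := fun r k ↦ prod_range_succ _ _
  have hPs' : ∀ r k, P r (k + 1) = P (r + 1) k * (n - r - 1) := fun r k ↦ by
    simp only [hP, prod_range_succ', Nat.cast_zero, sub_zero]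
    congr 1
    refine prod_congr rfl fun i _ ↦ ?_
    push_cast; ring
  have hsum := eq_sum_choose_of_recurrence (3 : ℚ)
    (fun r ↦ -2 * ((n : ℚ) - 2 * r - ((n - 1) % 2 : ℕ)) / (n - r - 1))
    (fun r k ↦ W r k / P r k) (n / 2) (fun r ↦ by simp [hP, hW0])
    (fun r k h ↦ by
      have hw := congrArg (Int.cast : ℤ → ℚ) (hW r (k + 1) (by omega) (by omega))
      simp only [Int.cast_sub, Int.cast_mul, Int.cast_natCast, Int.cast_ofNat, Nat.cast_add_one,
        Int.cast_add, Int.cast_one, Nat.add_sub_cancel] at hw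
      have a1 := hP0 r k (by omega)
      have a3 := hpos r k h
      have b1 : 3 * ((W r k : ℚ) / P r k) = 3 * (n - r - 1 - k) * W r k / P r (k + 1) := by
        rw [hPs]; field_simp
      have b2 : -2 * ((n : ℚ) - 2 * r - ((n - 1) % 2 : ℕ)) / (n - r - 1) *
          (W (r + 1) k / P (r + 1) k) =
          -2 * ((n : ℚ) - 2 * r - ((n - 1) % 2 : ℕ)) * W (r + 1) k / P r (k + 1) := by
        rw [hPs', div_mul_div_comm, mul_comm (P _ _)]
      rw [b1, b2, ← add_div]
      congr 1
      rw [hw]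
      ring)
    (n / 2) 0 (by omega)
  have hL : (W 0 (n / 2) : ℚ) / P 0 (n / 2) = lucasSum n (n / 2) := by
    rw [hsum, lucasSum, Int.cast_sum]
    refine sum_congr rfl fun j hj ↦ ?_
    have hj' := mem_range.1 hj
    have := choose_mul_prod_eq_lucasCoeff hn j (by omega)
    simp only [zero_add]
    push_cast at this ⊢
    rw [← this]
    ring
  rw [div_eq_iff (hP0 0 _ (by omega))] at hL
  have hprod : P 0 (n / 2) = ((∏ j ∈ Finset.Icc 1 (n / 2), ((n : ℤ) - j) : ℤ) : ℚ) := by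
    rw [← Finset.Ico_succ_right_eq_Icc, Finset.prod_Ico_eq_prod_range]
    simp only [hP]
    push_cast
    refine prod_congr (by simp) fun i _ ↦ ?_
    ring
  rw [hprod] at hL
  exact_mod_cast hL
end
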